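/- arXiv:2401.00558 — 5 statements merged into one kernel-verified Lean document; each statement's English description precedes it below -/
import Mathlib

section
/- Let 0 < β < 1, γ ∈ ℝ and λ₁, λ₂ ∈ ℝ. Then the Horn-function kernels κ(x) = (x^{β−1}/Γ(β)) · Φ₃(γ; β; −λ₁x, λ₂x) and k(x) = (x^{−β}/Γ(1−β)) · Φ₃(−γ; 1−β; −λ₁x, −λ₂x) form a pair of Sonin kernels: for all x > 0, (κ * k)(x) = 1. -/
open MeasureTheory Real

/-- The Pochhammer symbol `(γ)ₙ = γ(γ+1)⋯(γ+n-1)`. -/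
noncomputable def poch (γ : ℝ) (n : ℕ) : ℝ := ∏ i ∈ Finset.range n, (γ + i)

/-- The Horn confluent hypergeometric function
`Φ₃(γ;β;y,z) = Σ_{m,n} (γ)ₘ/(β)_{m+n} · yᵐzⁿ/(m!n!)`. -/
noncomputable def hornPhi3 (γ β y z : ℝ) : ℝ :=
  ∑' q : ℕ × ℕ, poch γ q.1 / poch β (q.1 + q.2) * y ^ q.1 * z ^ q.2 /
    ((q.1.factorial : ℝ) * (q.2.factorial : ℝ))

lemma poch_succ (γ : ℝ) (n : ℕ) : poch γ (n + 1) = poch γ n * (γ + n) := by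
  simp [poch, Finset.prod_range_succ]

lemma poch_pos {γ : ℝ} (hγ : 0 < γ) (n : ℕ) : 0 < poch γ n :=
  Finset.prod_pos fun i _ => by positivity

/-- The Pochhammer symbol as a ratio of Gamma values. -/
lemma Gamma_add_nat_eq_mul_poch {γ : ℝ} (hγ : 0 < γ) (n : ℕ) :
    Gamma (γ + n) = Gamma γ * poch γ n := by
  induction n with
  | zero => simp [poch]
  | succ n ih =>
    rw [poch_succ, ← mul_assoc, ← ih, mul_comm, ← Real.Gamma_add_one (by positivity)]
    push_cast
    ring_nf

lemma pow_mul_factorial_le_poch {β : ℝ} (hβ0 : 0 < β) (hβ1 : β ≤ 1) (n : ℕ) :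
    β ^ n * n.factorial ≤ poch β n := by
  induction n with
  | zero => simp [poch]
  | succ n ih =>
    rw [poch_succ, pow_succ, Nat.factorial_succ]
    push_cast
    calc β ^ n * β * ((n + 1) * n.factorial) = β ^ n * n.factorial * (β * n + β) := by ring
      _ ≤ poch β n * (β + n) := by
        refine mul_le_mul ih ?_ (by positivity) (poch_pos hβ0 n).le
        nlinarith [(Nat.cast_nonneg n : (0 : ℝ) ≤ n)]

lemma abs_poch_le (γ : ℝ) (n : ℕ) : |poch γ n| ≤ (1 + |γ|) ^ n * n.factorial := by
  induction n with
  | zero => simp [poch]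
  | succ n ih =>
    rw [poch_succ, abs_mul, pow_succ, Nat.factorial_succ]
    push_cast
    calc |poch γ n| * |γ + n|
        ≤ ((1 + |γ|) ^ n * n.factorial) * ((1 + |γ|) * (n + 1)) := by
          gcongr
          have h := abs_add_le γ n
          rw [Nat.abs_cast] at h
          nlinarith [(Nat.cast_nonneg n : (0 : ℝ) ≤ n), abs_nonneg γ]
      _ = _ := by ring

lemma poch_div_factorial_eq_multichoose (γ : ℝ) (n : ℕ) :
    poch γ n / n.factorial = Ring.multichoose γ n := by
  have h := Ring.factorial_nsmul_multichoose_eq_ascPochhammer γ n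
  rw [nsmul_eq_mul] at h
  rw [div_eq_iff (by positivity), mul_comm, h]
  induction n with
  | zero => simp [poch]
  | succ n ih =>
    rw [poch_succ, ih (by simpa using Ring.factorial_nsmul_multichoose_eq_ascPochhammer γ n),
      ascPochhammer_succ_right, Polynomial.smeval_mul, Polynomial.smeval_add,
      Polynomial.smeval_X, Polynomial.smeval_natCast]
    simp

/-- The power series of `(1 - X) ^ (-γ)`. -/
noncomputable def pochSeries (γ : ℝ) : PowerSeries ℝ :=
  PowerSeries.mk fun n => poch γ n / n.factorial

lemma pochSeries_eq_rescale_binomialSeries (γ : ℝ) :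
    pochSeries γ = PowerSeries.rescale (-1) (PowerSeries.binomialSeries ℝ (-γ)) := by
  ext n
  rw [pochSeries, PowerSeries.coeff_mk, poch_div_factorial_eq_multichoose,
    PowerSeries.coeff_rescale, PowerSeries.binomialSeries_coeff, Ring.choose_neg',
    smul_eq_mul, mul_one, Units.smul_def, zsmul_eq_mul, Int.cast_negOnePow_natCast, ← mul_assoc,
    ← mul_pow]
  simp

lemma pochSeries_mul_pochSeries_neg (γ : ℝ) : pochSeries γ * pochSeries (-γ) = 1 := by
  rw [pochSeries_eq_rescale_binomialSeries, pochSeries_eq_rescale_binomialSeries, ← map_mul,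
    ← PowerSeries.binomialSeries_add]
  simp

/-- The power series of `(1 - a X) ^ (-γ) * exp (b X)`. -/
noncomputable def hornSeries (γ a b : ℝ) : PowerSeries ℝ :=
  PowerSeries.rescale a (pochSeries γ) * PowerSeries.rescale b (PowerSeries.exp ℝ)

lemma coeff_hornSeries (γ a b : ℝ) (n : ℕ) :
    PowerSeries.coeff n (hornSeries γ a b) = ∑ p ∈ Finset.HasAntidiagonal.antidiagonal n,
      a ^ p.1 * (poch γ p.1 / p.1.factorial) * (b ^ p.2 / p.2.factorial) := by
  simp [hornSeries, pochSeries, PowerSeries.coeff_mul, PowerSeries.coeff_exp, div_eq_mul_inv]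

lemma hornSeries_mul_hornSeries_neg (γ a b : ℝ) :
    hornSeries γ a b * hornSeries (-γ) a (-b) = 1 := by
  have h : PowerSeries.rescale (-b) (PowerSeries.exp ℝ) =
      PowerSeries.rescale b (PowerSeries.evalNegHom (PowerSeries.exp ℝ)) := by
    rw [PowerSeries.evalNegHom, PowerSeries.rescale_rescale, neg_one_mul]
  rw [hornSeries, hornSeries, mul_mul_mul_comm, ← map_mul, pochSeries_mul_pochSeries_neg, h,
    ← map_mul, PowerSeries.exp_mul_exp_neg_eq_one]
  simp

lemma abs_coeff_hornSeries_le (γ a b : ℝ) (n : ℕ) :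
    |PowerSeries.coeff n (hornSeries γ a b)| ≤ (|a| * (1 + |γ|) + |b|) ^ n := by
  rw [coeff_hornSeries, (Commute.all _ _).add_pow']
  refine (Finset.abs_sum_le_sum_abs _ _).trans (Finset.sum_le_sum fun p hp => ?_)
  have h1 : |poch γ p.1| / p.1.factorial ≤ (1 + |γ|) ^ p.1 := by
    rw [div_le_iff₀ (by positivity)]
    exact abs_poch_le γ p.1
  have h2 : |b| ^ p.2 / p.2.factorial ≤ |b| ^ p.2 :=
    div_le_self (by positivity)
      (by exact_mod_cast Nat.one_le_iff_ne_zero.2 (Nat.factorial_ne_zero _))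
  have h3 : (1 : ℝ) ≤ n.choose p.1 := by
    exact_mod_cast Nat.choose_pos (Finset.HasAntidiagonal.antidiagonal.fst_le hp)
  rw [abs_mul, abs_mul, abs_div, abs_div, abs_pow, abs_pow, Nat.abs_cast, Nat.abs_cast,
    nsmul_eq_mul, mul_pow]
  calc _ ≤ |a| ^ p.1 * (1 + |γ|) ^ p.1 * |b| ^ p.2 := by gcongr
    _ ≤ _ := le_mul_of_one_le_left (by positivity) h3

/-- A series over `ℕ × ℕ` may be summed along antidiagonals. -/
lemma tsum_prod_eq_tsum_sum_antidiagonal {f : ℕ × ℕ → ℝ} (hf : Summable f) :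
    ∑' q, f q = ∑' n, ∑ p ∈ Finset.HasAntidiagonal.antidiagonal n, f p := by
  rw [← Finset.HasAntidiagonal.sigmaAntidiagonalEquivProd.tsum_eq f]
  refine (Summable.tsum_sigma' (fun n => (hasSum_fintype _).summable)
    (Finset.HasAntidiagonal.sigmaAntidiagonalEquivProd.summable_iff.2 hf)).trans
      (tsum_congr fun n => ?_)
  rw [tsum_fintype]
  exact Finset.sum_coe_sort _ f

lemma factorial_mul_factorial_le_factorial_add (m n : ℕ) :
    (m.factorial * n.factorial : ℝ) ≤ (m + n).factorial := by
  exact_mod_cast Nat.le_of_dvd (Nat.factorial_pos _)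
    (Nat.factorial_mul_factorial_dvd_factorial_add m n)

lemma summable_pow_div_factorial_mul (r s : ℝ) :
    Summable fun q : ℕ × ℕ => r ^ q.1 / q.1.factorial * (s ^ q.2 / q.2.factorial) :=
  summable_mul_of_summable_norm (Real.summable_pow_div_factorial r).norm
    (Real.summable_pow_div_factorial s).norm

lemma summable_hornPhi3 (γ : ℝ) {β : ℝ} (hβ0 : 0 < β) (hβ1 : β ≤ 1) (y z : ℝ) :
    Summable fun q : ℕ × ℕ => poch γ q.1 / poch β (q.1 + q.2) * y ^ q.1 * z ^ q.2 /
      ((q.1.factorial : ℝ) * (q.2.factorial : ℝ)) := by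
  refine .of_norm_bounded
    (summable_pow_div_factorial_mul ((1 + |γ|) * |y| / β) (|z| / β)) fun ⟨m, n⟩ => ?_
  have hβ : β ^ (m + n) * (m.factorial * n.factorial) ≤ poch β (m + n) :=
    (mul_le_mul_of_nonneg_left (factorial_mul_factorial_le_factorial_add m n)
      (by positivity)).trans (pow_mul_factorial_le_poch hβ0 hβ1 _)
  have hn : (1 : ℝ) ≤ n.factorial := by
    exact_mod_cast Nat.one_le_iff_ne_zero.2 (Nat.factorial_ne_zero _)
  simp only [norm_eq_abs, abs_div, abs_mul, abs_pow, Nat.abs_cast,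
    abs_of_pos (poch_pos hβ0 (m + n))]
  calc |poch γ m| / poch β (m + n) * |y| ^ m * |z| ^ n / (m.factorial * n.factorial)
      ≤ (1 + |γ|) ^ m * m.factorial / (β ^ (m + n) * (m.factorial * n.factorial)) *
          |y| ^ m * |z| ^ n / (m.factorial * 1) := by
        gcongr
        exact abs_poch_le γ m
    _ = _ := by
        rw [pow_add, div_pow, div_pow, mul_pow]
        field_simp

lemma hornPhi3_eq_tsum (γ : ℝ) {β : ℝ} (hβ0 : 0 < β) (hβ1 : β ≤ 1) (a b u : ℝ) :
    hornPhi3 γ β (a * u) (b * u) =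
      ∑' n, PowerSeries.coeff n (hornSeries γ a b) * u ^ n / poch β n := by
  rw [hornPhi3, tsum_prod_eq_tsum_sum_antidiagonal (summable_hornPhi3 γ hβ0 hβ1 _ _)]
  refine tsum_congr fun n => ?_
  rw [coeff_hornSeries, Finset.sum_mul, Finset.sum_div]
  refine Finset.sum_congr rfl fun p hp => ?_
  rw [← Finset.HasAntidiagonal.mem_antidiagonal.1 hp, mul_pow, mul_pow, pow_add]
  field_simp

lemma summable_norm_mul_pow_div_poch {c : ℕ → ℝ} {D β : ℝ} (hc : ∀ n, |c n| ≤ D ^ n)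
    (hβ0 : 0 < β) (hβ1 : β ≤ 1) (u : ℝ) :
    Summable fun n => ‖c n * u ^ n / poch β n‖ := by
  refine .of_nonneg_of_le (fun _ => norm_nonneg _) (fun n => ?_)
    (Real.summable_pow_div_factorial (D * |u| / β))
  rw [norm_eq_abs, abs_div, abs_mul, abs_pow, abs_of_pos (poch_pos hβ0 n), div_pow, mul_pow,
    div_div]
  have := (abs_nonneg _).trans (hc n)
  gcongr
  · exact hc n
  · exact pow_mul_factorial_le_poch hβ0 hβ1 n

/-- The Beta integral over `[0, x]`. -/
lemma integral_sub_rpow_mul_rpow {s t x : ℝ} (hs : 0 < s) (ht : 0 < t) (hx : 0 < x) :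
    ∫ ξ in (0 : ℝ)..x, (x - ξ) ^ (s - 1) * ξ ^ (t - 1) =
      x ^ (s + t - 1) * (Gamma s * Gamma t / Gamma (s + t)) := by
  have h := Complex.betaIntegral_scaled t s hx
  rw [Complex.betaIntegral_eq_Gamma_mul_div _ _ (by simpa) (by simpa)] at h
  have hl : ∫ ξ in (0 : ℝ)..x, (ξ : ℂ) ^ ((t : ℂ) - 1) * ((x : ℂ) - ξ) ^ ((s : ℂ) - 1) =
      ((∫ ξ in (0 : ℝ)..x, (x - ξ) ^ (s - 1) * ξ ^ (t - 1) : ℝ) : ℂ) := by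
    rw [← intervalIntegral.integral_ofReal]
    refine intervalIntegral.integral_congr fun ξ hξ => ?_
    rw [Set.uIcc_of_le hx.le] at hξ
    rw [Complex.ofReal_mul, Complex.ofReal_cpow (sub_nonneg.2 hξ.2), Complex.ofReal_cpow hξ.1]
    push_cast
    ring
  rw [hl, ← Complex.ofReal_add, ← Complex.ofReal_one, ← Complex.ofReal_sub,
    ← Complex.ofReal_cpow hx.le, Complex.Gamma_ofReal, Complex.Gamma_ofReal,
    Complex.Gamma_ofReal] at h
  have h' : ∫ ξ in (0 : ℝ)..x, (x - ξ) ^ (s - 1) * ξ ^ (t - 1) =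
      x ^ (t + s - 1) * (Gamma t * Gamma s / Gamma (t + s)) := by exact_mod_cast h
  rw [h', add_comm t s, mul_comm (Gamma t)]

lemma intervalIntegrable_sub_rpow_mul_rpow {s t x : ℝ} (hs : 0 < s) (ht : 0 < t) (hx : 0 < x) :
    IntervalIntegrable (fun ξ => (x - ξ) ^ (s - 1) * ξ ^ (t - 1)) volume 0 x := by
  refine intervalIntegral.intervalIntegrable_of_integral_ne_zero ?_
  rw [integral_sub_rpow_mul_rpow hs ht hx]
  have := Gamma_pos_of_pos hs
  have := Gamma_pos_of_pos ht
  have := Gamma_pos_of_pos (add_pos hs ht)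
  positivity

/-- Weighted power series whose coefficients are Cauchy inverses of each other are Sonin kernels. -/
lemma integral_mul_eq_one_of_cauchy_inverse {a b : ℕ → ℝ} {D E β x : ℝ}
    (ha : ∀ n, |a n| ≤ D ^ n) (hb : ∀ n, |b n| ≤ E ^ n)
    (hab : ∀ n, ∑ p ∈ Finset.HasAntidiagonal.antidiagonal n, a p.1 * b p.2 = if n = 0 then 1 else 0)
    (hβ0 : 0 < β) (hβ1 : β < 1) (hx : 0 < x) :
    ∫ ξ in (0 : ℝ)..x,
      ((x - ξ) ^ (β - 1) / Gamma β * ∑' n, a n * (x - ξ) ^ n / poch β n) *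
      (ξ ^ (-β) / Gamma (1 - β) * ∑' n, b n * ξ ^ n / poch (1 - β) n) = 1 := by
  have hβ' : 0 < 1 - β := by linarith
  set W : ℕ × ℕ → ℝ → ℝ := fun q ξ =>
    (x - ξ) ^ (β + q.1 - 1) * ξ ^ (1 - β + q.2 - 1) with hW
  set C : ℕ × ℕ → ℝ := fun q => a q.1 * b q.2 / (Gamma (β + q.1) * Gamma (1 - β + q.2)) with hC
  have hG1 : ∀ n : ℕ, 0 < Gamma (β + n) := fun n => Gamma_pos_of_pos (by positivity)
  have hG2 : ∀ n : ℕ, 0 < Gamma (1 - β + n) := fun n => Gamma_pos_of_pos (by positivity)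
  have hWint : ∀ q, ∫ ξ in Set.Ioo 0 x, W q ξ =
      x ^ (q.1 + q.2) * (Gamma (β + q.1) * Gamma (1 - β + q.2) / (q.1 + q.2).factorial) := by
    intro q
    rw [← integral_Ioc_eq_integral_Ioo, ← intervalIntegral.integral_of_le hx.le,
      integral_sub_rpow_mul_rpow (by positivity) (by positivity) hx,
      show β + q.1 + (1 - β + q.2) = ((q.1 + q.2 : ℕ) : ℝ) + 1 by push_cast; ring,
      Real.Gamma_nat_eq_factorial, add_sub_cancel_right, rpow_natCast]
  have hWi : ∀ q, IntegrableOn (W q) (Set.Ioo 0 x) := fun q =>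
    ((intervalIntegrable_iff_integrableOn_Ioo_of_le hx.le).1
      (intervalIntegrable_sub_rpow_mul_rpow (by positivity) (by positivity) hx))
  have hCW : ∀ q, C q * ∫ ξ in Set.Ioo 0 x, W q ξ =
      a q.1 * b q.2 * (x ^ (q.1 + q.2) / (q.1 + q.2).factorial) := by
    intro q
    have := (hG1 q.1).ne'
    have := (hG2 q.2).ne'
    rw [hWint, hC]
    field_simp
  have hnorm : ∀ q, ∫ ξ in Set.Ioo 0 x, ‖C q * W q ξ‖ =
      |a q.1| * |b q.2| * (x ^ (q.1 + q.2) / (q.1 + q.2).factorial) := by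
    intro q
    have h : ∫ ξ in Set.Ioo 0 x, ‖C q * W q ξ‖ = |C q| * ∫ ξ in Set.Ioo 0 x, W q ξ := by
      rw [← integral_const_mul]
      refine setIntegral_congr_fun measurableSet_Ioo fun ξ hξ => ?_
      have : 0 ≤ W q ξ := mul_nonneg (rpow_nonneg (sub_nonneg.2 hξ.2.le) _) (rpow_nonneg hξ.1.le _)
      simp only [norm_mul, norm_eq_abs, abs_of_nonneg this]
    have h0 : 0 ≤ ∫ ξ in Set.Ioo 0 x, W q ξ := by
      have := hG1 q.1
      have := hG2 q.2
      rw [hWint]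
      positivity
    rw [h, ← abs_of_nonneg h0, ← abs_mul, hCW, abs_mul, abs_mul,
      abs_of_nonneg (by positivity : 0 ≤ x ^ (q.1 + q.2) / ((q.1 + q.2).factorial : ℝ))]
  have hsum : Summable fun q => ∫ ξ in Set.Ioo 0 x, ‖C q * W q ξ‖ := by
    refine .of_nonneg_of_le (fun q => integral_nonneg fun _ => norm_nonneg _) (fun q => ?_)
      (summable_pow_div_factorial_mul (D * x) (E * x))
    have := (abs_nonneg _).trans (ha q.1)
    have := (abs_nonneg _).trans (hb q.2)
    rw [hnorm]
    calc _ ≤ D ^ q.1 * E ^ q.2 * (x ^ (q.1 + q.2) / (q.1.factorial * q.2.factorial)) := by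
          gcongr
          · exact ha _
          · exact hb _
          · exact factorial_mul_factorial_le_factorial_add _ _
      _ = _ := by
          rw [pow_add, mul_pow, mul_pow]
          field_simp
  have key := hasSum_integral_of_summable_integral_norm (μ := volume.restrict (Set.Ioo 0 x))
    (F := fun q ξ => C q * W q ξ) (fun q => (hWi q).const_mul (C q)) hsum
  simp only [integral_const_mul, hCW] at key
  rw [intervalIntegral.integral_of_le hx.le, integral_Ioc_eq_integral_Ioo]
  calc _ = ∫ ξ in Set.Ioo 0 x, ∑' q, C q * W q ξ := by
        refine setIntegral_congr_fun measurableSet_Ioo fun ξ hξ => ?_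
        have hξ' : 0 < x - ξ := sub_pos.2 hξ.2
        rw [mul_mul_mul_comm, tsum_mul_tsum_of_summable_norm
          (summable_norm_mul_pow_div_poch ha hβ0 hβ1.le _)
          (summable_norm_mul_pow_div_poch hb hβ' (by linarith) _), ← tsum_mul_left]
        refine tsum_congr fun q => ?_
        simp only [hC, hW]
        rw [Gamma_add_nat_eq_mul_poch hβ0, Gamma_add_nat_eq_mul_poch hβ',
          show β + q.1 - 1 = β - 1 + q.1 by ring, show 1 - β + q.2 - 1 = -β + q.2 by ring,
          rpow_add hξ', rpow_add hξ.1, rpow_natCast, rpow_natCast]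
        field_simp
    _ = 1 := by
        rw [← key.tsum_eq, tsum_prod_eq_tsum_sum_antidiagonal key.summable]
        have h : ∀ n, ∑ p ∈ Finset.HasAntidiagonal.antidiagonal n,
            a p.1 * b p.2 * (x ^ (p.1 + p.2) / (p.1 + p.2).factorial) =
              if n = 0 then 1 else 0 := by
          intro n
          rw [Finset.sum_congr rfl fun p hp => by rw [Finset.HasAntidiagonal.mem_antidiagonal.1 hp],
            ← Finset.sum_mul, hab]
          split_ifs with hn <;> simp [hn]
        simp only [h, tsum_ite_eq]

/-- The Horn-function kernels `(x^{β-1}/Γ(β))·Φ₃(γ;β;-λ₁x,λ₂x)` and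
`(x^{-β}/Γ(1-β))·Φ₃(-γ;1-β;-λ₁x,-λ₂x)` form a pair of Sonin kernels. -/
theorem hornPhi3_kernels_sonin (β γ lam₁ lam₂ : ℝ) (hβ0 : 0 < β) (hβ1 : β < 1)
    (x : ℝ) (hx : 0 < x) :
    ∫ ξ in (0:ℝ)..x,
      ((x - ξ) ^ (β - 1) / Real.Gamma β * hornPhi3 γ β (-(lam₁ * (x - ξ))) (lam₂ * (x - ξ))) *
      (ξ ^ (-β) / Real.Gamma (1 - β) * hornPhi3 (-γ) (1 - β) (-(lam₁ * ξ)) (-(lam₂ * ξ))) = 1 := by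
  simp only [← neg_mul, hornPhi3_eq_tsum _ hβ0 hβ1.le,
    hornPhi3_eq_tsum _ (show 0 < 1 - β by linarith) (show 1 - β ≤ 1 by linarith)]
  refine integral_mul_eq_one_of_cauchy_inverse (abs_coeff_hornSeries_le _ _ _)
    (abs_coeff_hornSeries_le _ _ _) (fun n => ?_) hβ0 hβ1 hx
  rw [← PowerSeries.coeff_mul, hornSeries_mul_hornSeries_neg, PowerSeries.coeff_one]
end

section
/- Let α₁ > 0, α₂ > 0, β > 0, γ ∈ ℝ, λ₁, λ₂ ∈ ℝ and p > 0 with |λ₁| p^{−α₁} < 1. Then the Laplace transform of the kernel x^{β−1} φ₃(γ; (α₁,α₂;β); −λ₁ x^{α₁}, λ₂ x^{α₂}) equals p^{α₁γ−β} (p^{α₁} + λ₁)^{−γ} exp(λ₂ p^{−α₂}): ∫₀^∞ e^{−px} x^{β−1} φ₃(γ; (α₁,α₂;β); −λ₁ x^{α₁}, λ₂ x^{α₂}) dx = p^{α₁γ−β} (p^{α₁} + λ₁)^{−γ} e^{λ₂ p^{−α₂}}. -/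
open MeasureTheory Real

/-- The generalized Horn-type function
`φ₃(γ;(α₁,α₂;β);y,z) = Σ_{m,n} (γ)ₘ/Γ(α₁m+α₂n+β) · yᵐzⁿ/(m!n!)`. -/
noncomputable def phi3 (γ α₁ α₂ β y z : ℝ) : ℝ :=
  ∑' q : ℕ × ℕ, poch γ q.1 / Real.Gamma (α₁ * q.1 + α₂ * q.2 + β) * y ^ q.1 * z ^ q.2 /
    ((q.1.factorial : ℝ) * (q.2.factorial : ℝ))

/-- The product `poch` is the evaluation of Mathlib's rising factorial polynomial. -/
lemma poch_eq_ascPochhammer_eval (γ : ℝ) (n : ℕ) : poch γ n = (ascPochhammer ℝ n).eval γ := by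
  induction n with
  | zero => simp [poch]
  | succ n ih => rw [ascPochhammer_succ_eval, ← ih, poch, Finset.prod_range_succ, ← poch]

lemma poch_div_factorial (γ : ℝ) (n : ℕ) :
    poch γ n / n.factorial = Ring.choose (γ + n - 1) n := by
  have h := Ring.factorial_nsmul_multichoose_eq_ascPochhammer γ n
  rw [Polynomial.ascPochhammer_smeval_eq_eval, ← poch_eq_ascPochhammer_eval, nsmul_eq_mul] at h
  rw [← Ring.multichoose_eq, ← h, mul_div_cancel_left₀ _ (by positivity)]

/-- The binomial series with coefficients written through the Pochhammer symbol. -/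
lemma hasSum_poch_mul_pow (γ : ℝ) {u : ℝ} (hu : |u| < 1) :
    HasSum (fun n : ℕ => poch γ n / n.factorial * u ^ n) ((1 - u) ^ (-γ)) := by
  have h := (one_div_one_sub_rpow_hasFPowerSeriesOnBall_zero γ).hasSum (y := u)
    (by simpa [enorm_eq_nnnorm, ← NNReal.coe_lt_coe] using hu)
  have hpos : 0 ≤ 1 - u := by linarith [(abs_lt.mp hu).2]
  rw [rpow_neg hpos]
  simpa [poch_div_factorial, FormalMultilinearSeries.ofScalars] using h

lemma integrableOn_rpow_mul_exp_neg_mul_Ioi {a r : ℝ} (ha : 0 < a) (hr : 0 < r) :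
    IntegrableOn (fun t : ℝ => t ^ (a - 1) * exp (-(r * t))) (Set.Ioi 0) := by
  refine Integrable.of_integral_ne_zero ?_
  rw [integral_rpow_mul_exp_neg_mul_Ioi ha hr]
  have := Gamma_pos_of_pos ha
  positivity

/-- Termwise Laplace transform of a series of real powers. -/
lemma hasSum_laplace_rpow {ι : Type*} [Countable ι] {p : ℝ} (hp : 0 < p) {c s : ι → ℝ}
    (hs : ∀ i, 0 < s i) (hsum : Summable fun i => c i * ((1 / p) ^ s i * Gamma (s i))) :
    HasSum (fun i => c i * ((1 / p) ^ s i * Gamma (s i)))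
      (∫ x in Set.Ioi (0 : ℝ), ∑' i, c i * (x ^ (s i - 1) * exp (-(p * x)))) := by
  have h := hasSum_integral_of_summable_integral_norm (μ := volume.restrict (Set.Ioi (0 : ℝ)))
    (F := fun i x => c i * (x ^ (s i - 1) * exp (-(p * x))))
    (fun i => (integrableOn_rpow_mul_exp_neg_mul_Ioi (hs i) hp).const_mul (c i)) ?_
  · simpa only [integral_const_mul, integral_rpow_mul_exp_neg_mul_Ioi (hs _) hp] using h
  · refine hsum.abs.congr fun i => ?_
    have hΓ := Gamma_pos_of_pos (hs i)
    rw [abs_mul, abs_of_nonneg (show 0 ≤ (1 / p) ^ s i * Gamma (s i) by positivity),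
      ← integral_rpow_mul_exp_neg_mul_Ioi (hs i) hp, ← integral_const_mul]
    refine setIntegral_congr_fun measurableSet_Ioi fun x hx => ?_
    have hx : 0 < x := hx
    simp only [norm_mul, Real.norm_eq_abs, abs_exp, abs_of_nonneg (rpow_nonneg hx.le _)]

lemma rpow_mul_natCast_add (x a b c : ℝ) (hx : 0 < x) (m n : ℕ) :
    x ^ (a * m + b * n + c) = (x ^ a) ^ m * (x ^ b) ^ n * x ^ c := by
  rw [rpow_add hx, rpow_add hx, rpow_mul hx.le, rpow_mul hx.le, rpow_natCast, rpow_natCast]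

/-- The Laplace transform of the kernel `x^{β-1}φ₃(γ;(α₁,α₂;β);-λ₁x^{α₁},λ₂x^{α₂})` is
`p^{α₁γ-β}·(p^{α₁}+λ₁)^{-γ}·exp(λ₂p^{-α₂})`. -/
theorem laplace_phi3_kernel (α₁ α₂ β γ lam₁ lam₂ p : ℝ)
    (hα₁ : 0 < α₁) (hα₂ : 0 < α₂) (hβ : 0 < β) (hp : 0 < p)
    (hlam₁ : |lam₁| * p ^ (-α₁) < 1) :
    ∫ x in Set.Ioi (0:ℝ), Real.exp (-(p * x)) *
        (x ^ (β - 1) * phi3 γ α₁ α₂ β (-(lam₁ * x ^ α₁)) (lam₂ * x ^ α₂))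
      = p ^ (α₁ * γ - β) * (p ^ α₁ + lam₁) ^ (-γ) * Real.exp (lam₂ * p ^ (-α₂)) := by
  set u := -(lam₁ * p ^ (-α₁)) with hu
  set v := lam₂ * p ^ (-α₂) with hv
  have hu1 : |u| < 1 := by rwa [hu, abs_neg, abs_mul, abs_of_pos (rpow_pos_of_pos hp _)]
  have hA := hasSum_poch_mul_pow γ hu1
  have hB : HasSum (fun n : ℕ => v ^ n / n.factorial) (exp v) := by
    rw [exp_eq_exp_ℝ]
    exact NormedSpace.expSeries_div_hasSum_exp v
  have hAB := (hA.mul hB (summable_mul_of_summable_norm hA.summable.norm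
    hB.summable.norm)).mul_left (p ^ (-β))
  let s : ℕ × ℕ → ℝ := fun q => α₁ * q.1 + α₂ * q.2 + β
  have hs : ∀ q, 0 < s q := fun q => by positivity
  let c : ℕ × ℕ → ℝ := fun q => poch γ q.1 / Gamma (s q) * (-lam₁) ^ q.1 * lam₂ ^ q.2 /
    ((q.1.factorial : ℝ) * (q.2.factorial : ℝ))
  have hterm : (fun q => c q * ((1 / p) ^ s q * Gamma (s q))) = fun q : ℕ × ℕ =>
      p ^ (-β) * (poch γ q.1 / q.1.factorial * u ^ q.1 * (v ^ q.2 / q.2.factorial)) := by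
    funext q
    have hΓ := (Gamma_pos_of_pos (hs q)).ne'
    have hpow : (1 / p) ^ s q = (p ^ (-α₁)) ^ q.1 * (p ^ (-α₂)) ^ q.2 * p ^ (-β) := by
      rw [rpow_mul_natCast_add _ _ _ _ (one_div_pos.mpr hp)]
      simp only [one_div, inv_rpow hp.le, rpow_neg hp.le]
    rw [hpow, hu, hv, ← neg_mul, mul_pow, mul_pow]
    simp only [c]
    field_simp
  rw [← hterm] at hAB
  have hint := (hasSum_laplace_rpow hp hs hAB.summable).unique hAB
  have hkernel : ∀ x ∈ Set.Ioi (0 : ℝ), exp (-(p * x)) *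
      (x ^ (β - 1) * phi3 γ α₁ α₂ β (-(lam₁ * x ^ α₁)) (lam₂ * x ^ α₂)) =
      ∑' q, c q * (x ^ (s q - 1) * exp (-(p * x))) := by
    intro x hx
    rw [phi3, ← tsum_mul_left, ← tsum_mul_left]
    refine tsum_congr fun q => ?_
    have hpow : x ^ (s q - 1) = (x ^ α₁) ^ q.1 * (x ^ α₂) ^ q.2 * x ^ (β - 1) := by
      rw [← rpow_mul_natCast_add x α₁ α₂ (β - 1) hx, ← add_sub_assoc]
    rw [hpow, ← neg_mul lam₁, mul_pow, mul_pow]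
    simp only [c, s]
    ring
  rw [setIntegral_congr_fun measurableSet_Ioi hkernel, hint, ← mul_assoc]
  congr 1
  have hfac : p ^ α₁ + lam₁ = p ^ α₁ * (1 - u) := by
    have : p ^ α₁ ≠ 0 := (rpow_pos_of_pos hp _).ne'
    rw [hu, rpow_neg hp.le]
    field_simp
    ring
  have hone : 0 ≤ 1 - u := by linarith [(abs_lt.mp hu1).2]
  rw [hfac, mul_rpow (by positivity) hone, ← rpow_mul hp.le, ← mul_assoc, ← rpow_add hp]
  congr 2
  ring
end

section
/- Let 0 < β < 1, α₁ > 0, α₂ > 0, γ₁, γ₂ ∈ ℝ and λ₁, λ₂ ∈ ℝ. Then the kernels κ(x) = x^{β−1} ξ₂(γ₁; γ₂; (α₁,α₂;β); −λ₁ x^{α₁}, −λ₂ x^{α₂}) and k(x) = x^{−β} ξ₂(−γ₁; −γ₂; (α₁,α₂;1−β); −λ₁ x^{α₁}, −λ₂ x^{α₂}) form a pair of Sonin kernels: for all x > 0, (κ * k)(x) = 1. -/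
open MeasureTheory Real

/-- The generalized Horn-type function
`ξ₂(γ₁;γ₂;(α₁,α₂;β);y,z) = Σ_{m,n} (γ₁)ₘ(γ₂)ₙ/Γ(α₁m+α₂n+β) · yᵐzⁿ/(m!n!)`. -/
noncomputable def xi2 (γ₁ γ₂ α₁ α₂ β y z : ℝ) : ℝ :=
  ∑' q : ℕ × ℕ, poch γ₁ q.1 * poch γ₂ q.2 / Real.Gamma (α₁ * q.1 + α₂ * q.2 + β) *
    y ^ q.1 * z ^ q.2 / ((q.1.factorial : ℝ) * (q.2.factorial : ℝ))

open Filter Topology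

lemma poch_div_factorial_eq_choose (γ : ℝ) (n : ℕ) :
    poch γ n / n.factorial = (-1) ^ n * Ring.choose (-γ) n := by
  have hd : poch γ n = (ascPochhammer ℝ n).eval γ := by
    induction n with
    | zero => simp [poch]
    | succ n ih => rw [poch, Finset.prod_range_succ, ascPochhammer_succ_eval, ← ih, poch]
  have hm : (n.factorial : ℝ) * Ring.multichoose γ n = poch γ n := by
    rw [← nsmul_eq_mul, Ring.factorial_nsmul_multichoose_eq_ascPochhammer, hd,
      Polynomial.ascPochhammer_smeval_eq_eval]
  have hf : (n.factorial : ℝ) ≠ 0 := by positivity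
  rw [Ring.choose_neg', ← hm, mul_div_cancel_left₀ _ hf, Units.smul_def, zsmul_eq_mul,
    Int.coe_negOnePow_natCast, ← mul_assoc]
  push_cast
  rw [← mul_pow]
  simp

/-- The coefficients of `(1 - X) ^ (-γ)` and `(1 - X) ^ γ` are inverse to each other under
the Cauchy product. -/
lemma sum_antidiagonal_poch_mul_poch_neg (γ : ℝ) (n : ℕ) :
    ∑ ij ∈ Finset.HasAntidiagonal.antidiagonal n,
      (poch γ ij.1 / ij.1.factorial) * (poch (-γ) ij.2 / ij.2.factorial) =
        if n = 0 then 1 else 0 := by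
  have h := Ring.add_choose_eq n (Commute.all (-γ) γ)
  rw [neg_add_cancel, Ring.choose_zero_ite] at h
  have hs : ∀ ij ∈ Finset.HasAntidiagonal.antidiagonal n,
      (poch γ ij.1 / ij.1.factorial) * (poch (-γ) ij.2 / ij.2.factorial) =
        (-1) ^ n * (Ring.choose (-γ) ij.1 * Ring.choose γ ij.2) := by
    intro ij hij
    rw [poch_div_factorial_eq_choose, poch_div_factorial_eq_choose, neg_neg,
      ← Finset.HasAntidiagonal.mem_antidiagonal.mp hij, pow_add]
    ring
  rw [Finset.sum_congr rfl hs, ← Finset.mul_sum, ← h]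
  split_ifs with hn <;> simp [hn]

lemma abs_poch_div_factorial_le (γ : ℝ) (n : ℕ) :
    |poch γ n / n.factorial| ≤ (|γ| + 1) ^ n := by
  have hf : (0 : ℝ) < n.factorial := by positivity
  rw [abs_div, abs_of_pos hf, div_le_iff₀ hf, poch, Finset.abs_prod]
  calc ∏ i ∈ Finset.range n, |γ + i|
      ≤ ∏ i ∈ Finset.range n, ((|γ| + 1) * ((i : ℝ) + 1)) := by
        refine Finset.prod_le_prod (fun i _ => abs_nonneg _) fun i _ => ?_
        have h1 := abs_add_le γ (i : ℝ)
        rw [abs_of_nonneg (Nat.cast_nonneg (α := ℝ) i)] at h1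
        nlinarith [mul_nonneg (abs_nonneg γ) (Nat.cast_nonneg (α := ℝ) i)]
    _ = (|γ| + 1) ^ n * n.factorial := by
        rw [Finset.prod_mul_distrib, Finset.prod_const, Finset.card_range,
          ← Finset.prod_range_add_one_eq_factorial]
        push_cast
        rfl

/-- If the Cauchy product of `c` and `d` is the unit sequence, then a summable double series
`∑ c i * d j * G (i + j)` collapses to `G 0`. -/
lemma tsum_mul_mul_add_eq {c d G : ℕ → ℝ}
    (hcd : ∀ n, ∑ ij ∈ Finset.HasAntidiagonal.antidiagonal n, c ij.1 * d ij.2 = if n = 0 then 1 else 0)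
    (hs : Summable fun p : ℕ × ℕ => c p.1 * d p.2 * G (p.1 + p.2)) :
    ∑' p : ℕ × ℕ, c p.1 * d p.2 * G (p.1 + p.2) = G 0 := by
  let e := Finset.HasAntidiagonal.sigmaAntidiagonalEquivProd (A := ℕ)
  have hs' : Summable fun z => c (e z).1 * d (e z).2 * G ((e z).1 + (e z).2) :=
    e.summable_iff.mpr hs
  rw [← e.tsum_eq, Summable.tsum_sigma' (fun n => (hasSum_fintype _).summable) hs']
  have hn : ∀ n : ℕ, ∑' p : Finset.HasAntidiagonal.antidiagonal n,
      c (e ⟨n, p⟩).1 * d (e ⟨n, p⟩).2 * G ((e ⟨n, p⟩).1 + (e ⟨n, p⟩).2) =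
        if n = 0 then G 0 else 0 := by
    intro n
    refine (Finset.tsum_subtype (Finset.HasAntidiagonal.antidiagonal n)
      (fun p => c p.1 * d p.2 * G (p.1 + p.2))).trans ?_
    rw [Finset.sum_congr rfl (g := fun p => c p.1 * d p.2 * G n)
        (fun p hp => by rw [Finset.HasAntidiagonal.mem_antidiagonal.mp hp]), ← Finset.sum_mul, hcd n]
    split_ifs with h <;> simp [h]
  rw [tsum_congr hn, tsum_ite_eq]

/-- The reciprocal Gamma function decays faster than any exponential. -/
lemma exists_inv_Gamma_le_mul_rpow {ρ : ℝ} (hρ : 0 < ρ) :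
    ∃ C : ℝ, 0 < C ∧ ∀ u : ℝ, 0 < u → (Real.Gamma u)⁻¹ ≤ C * ρ ^ u := by
  set R := Real.exp 1 / ρ with hR
  have hRpos : 0 < R := by positivity
  refine ⟨Real.exp R, Real.exp_pos _, fun u hu => ?_⟩
  have hG : Real.exp (-R) * R ^ u ≤ Real.Gamma (u + 1) := by
    rw [Real.Gamma_eq_integral (by linarith), add_sub_cancel_right]
    have hF_int : IntegrableOn (fun t : ℝ => Real.exp (-t) * t ^ u) (Set.Ioi 0) := by
      simpa using Real.GammaIntegral_convergent (s := u + 1) (by linarith)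
    calc Real.exp (-R) * R ^ u = ∫ t in Set.Ioi R, Real.exp (-t) * R ^ u := by
          rw [integral_mul_const, integral_exp_neg_Ioi]
      _ ≤ ∫ t in Set.Ioi R, Real.exp (-t) * t ^ u := by
          refine setIntegral_mono_on ((integrableOn_exp_neg_Ioi R).mul_const _)
            (hF_int.mono_set (Set.Ioi_subset_Ioi hRpos.le)) measurableSet_Ioi fun t ht => ?_
          have : R ≤ t := le_of_lt ht
          gcongr
      _ ≤ ∫ t in Set.Ioi 0, Real.exp (-t) * t ^ u := by
          refine setIntegral_mono_set hF_int ?_ (Set.Ioi_subset_Ioi hRpos.le).eventuallyLE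
          filter_upwards [ae_restrict_mem measurableSet_Ioi] with t ht
          have : (0 : ℝ) < t := ht
          simp only [Pi.zero_apply]
          positivity
  have hGpos := Real.Gamma_pos_of_pos hu
  rw [Real.Gamma_add_one hu.ne'] at hG
  have hu' : u ≤ Real.exp u := by linarith [Real.add_one_le_exp u]
  have hRu : R ^ u = Real.exp u / ρ ^ u := by
    rw [hR, Real.div_rpow (Real.exp_pos _).le hρ.le, Real.exp_one_rpow]
  have hρu : 0 < ρ ^ u := by positivity
  have h1 : Real.exp (-R) * (Real.exp u / ρ ^ u) ≤ Real.exp u * Real.Gamma u := by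
    rw [← hRu]
    exact hG.trans (by gcongr)
  have h2 : Real.exp (-R) / ρ ^ u ≤ Real.Gamma u := by
    have : Real.exp u * (Real.exp (-R) / ρ ^ u) ≤ Real.exp u * Real.Gamma u := by
      convert h1 using 1
      ring
    exact le_of_mul_le_mul_left this (Real.exp_pos u)
  calc (Real.Gamma u)⁻¹ ≤ (Real.exp (-R) / ρ ^ u)⁻¹ := by gcongr
    _ = Real.exp R * ρ ^ u := by rw [inv_div, Real.exp_neg, div_inv_eq_mul, mul_comm]

lemma integral_sub_rpow_mul_rpow_s14 {a b x : ℝ} (ha : 0 < a) (hb : 0 < b) (hx : 0 < x) :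
    ∫ ξ in Set.Ioo 0 x, (x - ξ) ^ (a - 1) * ξ ^ (b - 1) =
      x ^ (a + b - 1) * (Real.Gamma a * Real.Gamma b / Real.Gamma (a + b)) := by
  have h := Complex.betaIntegral_scaled (b : ℂ) (a : ℂ) hx
  rw [Complex.betaIntegral_eq_Gamma_mul_div _ _ (by simpa) (by simpa),
    intervalIntegral.integral_of_le hx.le, integral_Ioc_eq_integral_Ioo] at h
  rw [← Complex.ofReal_inj, ← integral_complex_ofReal]
  rw [setIntegral_congr_fun measurableSet_Ioo (g := fun ξ : ℝ =>
    (ξ : ℂ) ^ ((b : ℂ) - 1) * ((x : ℂ) - ξ) ^ ((a : ℂ) - 1)), h]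
  · rw [← Complex.ofReal_add, Complex.Gamma_ofReal, Complex.Gamma_ofReal, Complex.Gamma_ofReal,
      add_comm b a]
    push_cast
    rw [Complex.ofReal_cpow hx.le]
    push_cast
    ring_nf
  · intro ξ hξ
    simp only [Complex.ofReal_mul]
    rw [Complex.ofReal_cpow (by linarith [hξ.2]), Complex.ofReal_cpow hξ.1.le]
    push_cast
    ring

lemma integrableOn_sub_rpow_mul_rpow {a b x : ℝ} (ha : 0 < a) (hb : 0 < b) (hx : 0 < x) :
    IntegrableOn (fun ξ : ℝ => (x - ξ) ^ (a - 1) * ξ ^ (b - 1)) (Set.Ioo 0 x) := by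
  refine Integrable.of_integral_ne_zero ?_
  rw [integral_sub_rpow_mul_rpow_s14 ha hb hx]
  have := Real.Gamma_pos_of_pos ha
  have := Real.Gamma_pos_of_pos hb
  have := Real.Gamma_pos_of_pos (add_pos ha hb)
  positivity

lemma eventually_summable_poch (γ l : ℝ) {α : ℝ} (hα : 0 < α) :
    ∀ᶠ ρ in 𝓝[>] (0 : ℝ),
      Summable fun m : ℕ => |poch γ m / m.factorial * l ^ m| * ρ ^ (α * m) := by
  have hlim : Tendsto (fun ρ : ℝ => (|γ| + 1) * |l| * ρ ^ α) (𝓝[>] 0) (𝓝 0) := by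
    have h : ContinuousAt (fun ρ : ℝ => (|γ| + 1) * |l| * ρ ^ α) 0 :=
      continuousAt_const.mul (Real.continuousAt_rpow_const _ _ (Or.inr hα.le))
    simpa [ContinuousAt, Real.zero_rpow hα.ne'] using h.tendsto.mono_left nhdsWithin_le_nhds
  filter_upwards [hlim.eventually_lt_const one_pos, self_mem_nhdsWithin] with ρ hρ hρ0
  have hρ0 : 0 < ρ := hρ0
  refine Summable.of_nonneg_of_le (fun m => by positivity) (fun m => ?_)
    (summable_geometric_of_lt_one (by positivity) hρ)
  rw [abs_mul, abs_pow, Real.rpow_mul hρ0.le, Real.rpow_natCast, mul_pow, mul_pow]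
  gcongr
  exact abs_poch_div_factorial_le γ m

/-- The coefficient of `t₁ ^ m * t₂ ^ n` in `(1 - l₁ t₁) ^ (-γ₁) * (1 - l₂ t₂) ^ (-γ₂)`. -/
noncomputable def hornCoeff (γ₁ γ₂ l₁ l₂ : ℝ) (q : ℕ × ℕ) : ℝ :=
  (poch γ₁ q.1 / q.1.factorial * l₁ ^ q.1) * (poch γ₂ q.2 / q.2.factorial * l₂ ^ q.2)

lemma eventually_summable_hornCoeff (γ₁ γ₂ l₁ l₂ : ℝ) {α₁ α₂ : ℝ} (hα₁ : 0 < α₁) (hα₂ : 0 < α₂) :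
    ∀ᶠ ρ in 𝓝[>] (0 : ℝ),
      Summable fun q : ℕ × ℕ => |hornCoeff γ₁ γ₂ l₁ l₂ q| * ρ ^ (α₁ * q.1 + α₂ * q.2) := by
  filter_upwards [eventually_summable_poch γ₁ l₁ hα₁, eventually_summable_poch γ₂ l₂ hα₂,
    self_mem_nhdsWithin] with ρ h₁ h₂ hρ0
  have hρ0 : 0 < ρ := hρ0
  refine (h₁.mul_of_nonneg h₂ (fun m => by positivity) (fun m => by positivity)).congr fun q => ?_
  rw [hornCoeff, abs_mul (_ * _) (_ * _), Real.rpow_add hρ0]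
  ring

/-- The general term of the expansion of `t ^ (b - 1) * ξ₂(…; l₁ t ^ α₁, l₂ t ^ α₂)` in powers
of `t`. -/
noncomputable def hornTerm (γ₁ γ₂ l₁ l₂ α₁ α₂ b t : ℝ) (q : ℕ × ℕ) : ℝ :=
  hornCoeff γ₁ γ₂ l₁ l₂ q / Real.Gamma (α₁ * q.1 + α₂ * q.2 + b) *
    t ^ (α₁ * q.1 + α₂ * q.2 + b - 1)

lemma rpow_mul_xi2_eq_tsum (γ₁ γ₂ lam₁ lam₂ α₁ α₂ b : ℝ) {t : ℝ} (ht : 0 < t) :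
    t ^ (b - 1) * xi2 γ₁ γ₂ α₁ α₂ b (-(lam₁ * t ^ α₁)) (-(lam₂ * t ^ α₂)) =
      ∑' q, hornTerm γ₁ γ₂ (-lam₁) (-lam₂) α₁ α₂ b t q := by
  rw [xi2, ← tsum_mul_left]
  refine tsum_congr fun q => ?_
  rw [hornTerm, hornCoeff, add_sub_assoc, Real.rpow_add ht, Real.rpow_add ht, Real.rpow_mul ht.le,
    Real.rpow_mul ht.le, Real.rpow_natCast, Real.rpow_natCast, ← neg_mul, ← neg_mul, mul_pow,
    mul_pow]
  field_simp

lemma summable_norm_hornTerm (γ₁ γ₂ l₁ l₂ : ℝ) {α₁ α₂ b t : ℝ} (hα₁ : 0 < α₁) (hα₂ : 0 < α₂)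
    (hb : 0 < b) (ht : 0 < t) :
    Summable fun q => ‖hornTerm γ₁ γ₂ l₁ l₂ α₁ α₂ b t q‖ := by
  obtain ⟨ρ, hs, hρ0⟩ :=
    ((eventually_summable_hornCoeff γ₁ γ₂ l₁ l₂ hα₁ hα₂).and self_mem_nhdsWithin).exists
  have hρ0 : 0 < ρ := hρ0
  obtain ⟨C, hC, hΓ⟩ := exists_inv_Gamma_le_mul_rpow (div_pos hρ0 ht)
  refine Summable.of_nonneg_of_le (fun q => norm_nonneg _) (fun q => ?_)
    (hs.mul_left (C * ρ ^ b * t ^ (-1 : ℝ)))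
  have hu : 0 < α₁ * q.1 + α₂ * q.2 + b := by positivity
  have hG := Real.Gamma_pos_of_pos hu
  rw [hornTerm, norm_mul, norm_div, Real.norm_eq_abs, Real.norm_of_nonneg hG.le,
    Real.norm_of_nonneg (by positivity), div_eq_mul_inv]
  calc |hornCoeff γ₁ γ₂ l₁ l₂ q| * (Real.Gamma (α₁ * q.1 + α₂ * q.2 + b))⁻¹ *
        t ^ (α₁ * q.1 + α₂ * q.2 + b - 1)
      ≤ |hornCoeff γ₁ γ₂ l₁ l₂ q| * (C * (ρ / t) ^ (α₁ * q.1 + α₂ * q.2 + b)) *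
        t ^ (α₁ * q.1 + α₂ * q.2 + b - 1) := by
        gcongr
        exact hΓ _ hu
    _ = _ := by
        have : t ^ (α₁ * q.1 + α₂ * q.2 + b) ≠ 0 := by positivity
        rw [Real.div_rpow hρ0.le ht.le, sub_eq_add_neg, Real.rpow_add ht _ (-1),
          Real.rpow_add hρ0 _ b]
        field_simp

/-- The Laplace convolution of two terms of the expansions. -/
noncomputable def hornConvTerm (γ₁ γ₂ l₁ l₂ α₁ α₂ x : ℝ) (p : (ℕ × ℕ) × (ℕ × ℕ)) : ℝ :=
  hornCoeff γ₁ γ₂ l₁ l₂ p.1 * hornCoeff (-γ₁) (-γ₂) l₁ l₂ p.2 *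
    (x ^ (α₁ * (p.1.1 + p.2.1 : ℕ) + α₂ * (p.1.2 + p.2.2 : ℕ)) /
      Real.Gamma (α₁ * (p.1.1 + p.2.1 : ℕ) + α₂ * (p.1.2 + p.2.2 : ℕ) + 1))

lemma summable_abs_hornConvTerm (γ₁ γ₂ l₁ l₂ : ℝ) {α₁ α₂ x : ℝ} (hα₁ : 0 < α₁) (hα₂ : 0 < α₂)
    (hx : 0 < x) : Summable fun p => |hornConvTerm γ₁ γ₂ l₁ l₂ α₁ α₂ x p| := by
  obtain ⟨ρ, ⟨hs, hs'⟩, hρ0⟩ :=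
    (((eventually_summable_hornCoeff γ₁ γ₂ l₁ l₂ hα₁ hα₂).and
      (eventually_summable_hornCoeff (-γ₁) (-γ₂) l₁ l₂ hα₁ hα₂)).and self_mem_nhdsWithin).exists
  have hρ0 : 0 < ρ := hρ0
  obtain ⟨C, hC, hΓ⟩ := exists_inv_Gamma_le_mul_rpow (div_pos hρ0 hx)
  refine Summable.of_nonneg_of_le (fun p => abs_nonneg _) (fun p => ?_)
    ((hs.mul_of_nonneg hs' (fun q => by positivity) (fun q => by positivity)).mul_left
      (C * (ρ / x)))
  rw [hornConvTerm]
  set s := α₁ * ((p.1.1 + p.2.1 : ℕ) : ℝ) + α₂ * ((p.1.2 + p.2.2 : ℕ) : ℝ) with hsdef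
  have hs0 : 0 ≤ s := by positivity
  have hG := Real.Gamma_pos_of_pos (by linarith : 0 < s + 1)
  have hsplit : s = (α₁ * p.1.1 + α₂ * p.1.2) + (α₁ * p.2.1 + α₂ * p.2.2) := by
    rw [hsdef]
    push_cast
    ring
  rw [abs_mul, abs_mul, abs_of_nonneg (by positivity : 0 ≤ x ^ s / Real.Gamma (s + 1)),
    div_eq_mul_inv (x ^ s)]
  calc |hornCoeff γ₁ γ₂ l₁ l₂ p.1| * |hornCoeff (-γ₁) (-γ₂) l₁ l₂ p.2| *
        (x ^ s * (Real.Gamma (s + 1))⁻¹)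
      ≤ |hornCoeff γ₁ γ₂ l₁ l₂ p.1| * |hornCoeff (-γ₁) (-γ₂) l₁ l₂ p.2| *
        (x ^ s * (C * (ρ / x) ^ (s + 1))) := by
        gcongr
        exact hΓ _ (by linarith)
    _ = |hornCoeff γ₁ γ₂ l₁ l₂ p.1| * |hornCoeff (-γ₁) (-γ₂) l₁ l₂ p.2| *
        (C * (ρ / x) * ρ ^ s) := by
        rw [Real.rpow_add_one (by positivity), Real.div_rpow hρ0.le hx.le]
        field_simp
    _ = _ := by
        rw [hsplit, Real.rpow_add hρ0]
        ring

lemma tsum_hornConvTerm (γ₁ γ₂ l₁ l₂ : ℝ) {α₁ α₂ x : ℝ} (hα₁ : 0 < α₁) (hα₂ : 0 < α₂)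
    (hx : 0 < x) : ∑' p, hornConvTerm γ₁ γ₂ l₁ l₂ α₁ α₂ x p = 1 := by
  have hs := (summable_abs_hornConvTerm γ₁ γ₂ l₁ l₂ hα₁ hα₂ hx).of_abs
  let e := Equiv.prodProdProdComm ℕ ℕ ℕ ℕ
  let G : ℕ → ℕ → ℝ := fun m n =>
    l₁ ^ m * l₂ ^ n * (x ^ (α₁ * m + α₂ * n) / Real.Gamma (α₁ * m + α₂ * n + 1))
  let c : ℝ → ℕ → ℝ := fun γ n => poch γ n / n.factorial
  have hterm : ∀ z : (ℕ × ℕ) × (ℕ × ℕ), hornConvTerm γ₁ γ₂ l₁ l₂ α₁ α₂ x (e z) =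
      c γ₁ z.1.1 * c (-γ₁) z.1.2 *
        (c γ₂ z.2.1 * c (-γ₂) z.2.2 * G (z.1.1 + z.1.2) (z.2.1 + z.2.2)) := by
    intro z
    simp only [hornConvTerm, hornCoeff, e, c, G, Equiv.prodProdProdComm_apply, pow_add]
    ring
  have hs' := (e.summable_iff.mpr hs).congr hterm
  rw [← e.tsum_eq, tsum_congr hterm, hs'.tsum_prod]
  have hinner : ∀ i : ℕ × ℕ, ∑' j : ℕ × ℕ, c γ₁ i.1 * c (-γ₁) i.2 *
      (c γ₂ j.1 * c (-γ₂) j.2 * G (i.1 + i.2) (j.1 + j.2)) =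
        c γ₁ i.1 * c (-γ₁) i.2 * G (i.1 + i.2) 0 := by
    intro i
    by_cases h0 : c γ₁ i.1 * c (-γ₁) i.2 = 0
    · simp [h0]
    · rw [tsum_mul_left, tsum_mul_mul_add_eq (sum_antidiagonal_poch_mul_poch_neg γ₂)]
      exact (summable_mul_left_iff h0).mp (hs'.prod_factor i)
  rw [tsum_congr hinner, tsum_mul_mul_add_eq (G := fun m => G m 0)
    (sum_antidiagonal_poch_mul_poch_neg γ₁) (hs'.prod.congr fun i => (hinner i))]
  simp [G]

/-- The kernels `x^{β-1}ξ₂(γ₁;γ₂;(α₁,α₂;β);-λ₁x^{α₁},-λ₂x^{α₂})` and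
`x^{-β}ξ₂(-γ₁;-γ₂;(α₁,α₂;1-β);-λ₁x^{α₁},-λ₂x^{α₂})` form a pair of Sonin kernels. -/
theorem xi2_kernels_sonin (α₁ α₂ β γ₁ γ₂ lam₁ lam₂ : ℝ)
    (hβ0 : 0 < β) (hβ1 : β < 1) (hα₁ : 0 < α₁) (hα₂ : 0 < α₂)
    (x : ℝ) (hx : 0 < x) :
    ∫ ξ in (0:ℝ)..x,
      ((x - ξ) ^ (β - 1) *
        xi2 γ₁ γ₂ α₁ α₂ β (-(lam₁ * (x - ξ) ^ α₁)) (-(lam₂ * (x - ξ) ^ α₂))) *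
      (ξ ^ (-β) *
        xi2 (-γ₁) (-γ₂) α₁ α₂ (1 - β) (-(lam₁ * ξ ^ α₁)) (-(lam₂ * ξ ^ α₂))) = 1 := by
  rw [intervalIntegral.integral_of_le hx.le, integral_Ioc_eq_integral_Ioo]
  have h1β : 0 < 1 - β := by linarith
  let F : (ℕ × ℕ) × (ℕ × ℕ) → ℝ → ℝ := fun p ξ =>
    hornTerm γ₁ γ₂ (-lam₁) (-lam₂) α₁ α₂ β (x - ξ) p.1 *
      hornTerm (-γ₁) (-γ₂) (-lam₁) (-lam₂) α₁ α₂ (1 - β) ξ p.2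
  rw [setIntegral_congr_fun measurableSet_Ioo (g := fun ξ => ∑' p, F p ξ)]
  swap
  · intro ξ hξ
    have hξ0 : 0 < ξ := hξ.1
    have hxξ : 0 < x - ξ := sub_pos.mpr hξ.2
    have hk := rpow_mul_xi2_eq_tsum (-γ₁) (-γ₂) lam₁ lam₂ α₁ α₂ (1 - β) hξ0
    rw [show 1 - β - 1 = -β by ring] at hk
    simp only [F]
    rw [rpow_mul_xi2_eq_tsum _ _ _ _ _ _ _ hxξ, hk]
    exact tsum_mul_tsum_of_summable_norm
      (summable_norm_hornTerm _ _ _ _ hα₁ hα₂ hβ0 hxξ)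
      (summable_norm_hornTerm _ _ _ _ hα₁ hα₂ h1β hξ0)
  let K : (ℕ × ℕ) × (ℕ × ℕ) → ℝ := fun p =>
    hornCoeff γ₁ γ₂ (-lam₁) (-lam₂) p.1 / Real.Gamma (α₁ * p.1.1 + α₂ * p.1.2 + β) *
      (hornCoeff (-γ₁) (-γ₂) (-lam₁) (-lam₂) p.2 /
        Real.Gamma (α₁ * p.2.1 + α₂ * p.2.2 + (1 - β)))
  let E : (ℕ × ℕ) × (ℕ × ℕ) → ℝ → ℝ := fun p ξ =>
    (x - ξ) ^ (α₁ * p.1.1 + α₂ * p.1.2 + β - 1) * ξ ^ (α₁ * p.2.1 + α₂ * p.2.2 + (1 - β) - 1)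
  have hFE : ∀ p, F p = fun ξ => K p * E p ξ := by
    intro p
    ext ξ
    simp only [F, K, E, hornTerm]
    ring
  have ha : ∀ p : (ℕ × ℕ) × (ℕ × ℕ), 0 < α₁ * p.1.1 + α₂ * p.1.2 + β := fun p => by positivity
  have hb : ∀ p : (ℕ × ℕ) × (ℕ × ℕ), 0 < α₁ * p.2.1 + α₂ * p.2.2 + (1 - β) :=
    fun p => by positivity
  have hKE : ∀ p, K p * ∫ ξ in Set.Ioo 0 x, E p ξ =
      hornConvTerm γ₁ γ₂ (-lam₁) (-lam₂) α₁ α₂ x p := by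
    intro p
    have hGa := (Real.Gamma_pos_of_pos (ha p)).ne'
    have hGb := (Real.Gamma_pos_of_pos (hb p)).ne'
    have hsum : α₁ * p.1.1 + α₂ * p.1.2 + β + (α₁ * p.2.1 + α₂ * p.2.2 + (1 - β)) =
        α₁ * (p.1.1 + p.2.1 : ℕ) + α₂ * (p.1.2 + p.2.2 : ℕ) + 1 := by
      push_cast
      ring
    rw [integral_sub_rpow_mul_rpow_s14 (ha p) (hb p) hx, hsum, add_sub_cancel_right, hornConvTerm]
    simp only [K]
    field_simp
  have hF_int : ∀ p, IntegrableOn (F p) (Set.Ioo 0 x) := fun p => by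
    rw [hFE p]
    exact (integrableOn_sub_rpow_mul_rpow (ha p) (hb p) hx).const_mul (K p)
  have hnorm : ∀ p, ∫ ξ in Set.Ioo 0 x, ‖F p ξ‖ =
      |hornConvTerm γ₁ γ₂ (-lam₁) (-lam₂) α₁ α₂ x p| := by
    intro p
    have hE : ∀ ξ ∈ Set.Ioo 0 x, 0 ≤ E p ξ := fun ξ hξ =>
      mul_nonneg (Real.rpow_nonneg (sub_nonneg.mpr hξ.2.le) _) (Real.rpow_nonneg hξ.1.le _)
    rw [← hKE p, abs_mul, abs_of_nonneg (setIntegral_nonneg measurableSet_Ioo hE),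
      ← integral_const_mul]
    refine setIntegral_congr_fun measurableSet_Ioo fun ξ hξ => ?_
    simp only [hFE p, norm_mul, Real.norm_eq_abs, abs_of_nonneg (hE ξ hξ)]
  have hsumm : Summable fun p => ∫ ξ in Set.Ioo 0 x, ‖F p ξ‖ := by
    simpa only [hnorm] using summable_abs_hornConvTerm γ₁ γ₂ (-lam₁) (-lam₂) hα₁ hα₂ hx
  rw [← integral_tsum_of_summable_integral_norm hF_int hsumm,
    ← tsum_hornConvTerm γ₁ γ₂ (-lam₁) (-lam₂) hα₁ hα₂ hx]
  refine tsum_congr fun p => ?_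
  rw [← hKE p, hFE p, integral_const_mul]
end

section
/- Let 0 < α < 1 and ρ > 0, and define the tempered power-law kernel h_{α,ρ}(x) = (x^{α−1}/Γ(α)) e^{−ρx}. Then the functions κ(x) = h_{α,ρ}(x) and k(x) = h_{1−α,ρ}(x) + ρ ∫₀ˣ h_{1−α,ρ}(ξ) dξ form a pair of Sonin kernels: for all x > 0, (κ * k)(x) = 1. -/
open MeasureTheory Real

/-- The tempered power-law kernel `h_{α,ρ}(x) = (x^{α-1}/Γ(α))·e^{-ρx}`. -/
noncomputable def temperedKernel (α ρ x : ℝ) : ℝ := x ^ (α - 1) / Real.Gamma α * Real.exp (-(ρ * x))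

open Set in
/-- Fubini's theorem on a triangle: convolving with the primitive of `g` amounts to
integrating the shifted convolutions with `g`. -/
theorem integral_mul_primitive_eq_integral_integral {f g : ℝ → ℝ} {x : ℝ} (hx : 0 ≤ x)
    (hf : IntervalIntegrable f volume 0 x) (hg : IntervalIntegrable g volume 0 x) :
    ∫ ξ in (0 : ℝ)..x, f ξ * ∫ t in (0 : ℝ)..ξ, g t =
      ∫ s in (0 : ℝ)..x, ∫ ξ in s..x, f ξ * g (ξ - s) := by
  set A : ℝ → ℝ := (Ioc 0 x).indicator f with hA
  set B : ℝ → ℝ := (Ioc 0 x).indicator g with hB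
  have hAi : Integrable A := by
    rw [hA, integrable_indicator_iff measurableSet_Ioc]
    exact (intervalIntegrable_iff_integrableOn_Ioc_of_le hx).1 hf
  have hBi : Integrable B := by
    rw [hB, integrable_indicator_iff measurableSet_Ioc]
    exact (intervalIntegrable_iff_integrableOn_Ioc_of_le hx).1 hg
  have hint : Integrable (fun p : ℝ × ℝ => A p.2 * B (p.2 - p.1)) (volume.prod volume) := by
    have h := hAi.convolution_integrand (ContinuousLinearMap.mul ℝ ℝ) hBi.comp_neg
    simpa using h
  have hint' : Integrable (Function.uncurry fun s ξ : ℝ => A ξ * B (ξ - s))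
      ((volume.restrict (Ioc 0 x)).prod volume) :=
    hint.mono_measure (Measure.prod_mono Measure.restrict_le_self le_rfl)
  have hswap := integral_integral_swap hint'
  rw [intervalIntegral.integral_of_le hx, intervalIntegral.integral_of_le hx]
  calc ∫ ξ in Ioc 0 x, f ξ * ∫ t in (0 : ℝ)..ξ, g t
      = ∫ ξ, ∫ s in Ioc 0 x, A ξ * B (ξ - s) := by
        rw [← integral_indicator measurableSet_Ioc]
        refine integral_congr_ae (.of_forall fun ξ => ?_)
        by_cases hξ : ξ ∈ Ioc 0 x
        · simp only [indicator_of_mem hξ, hA, integral_const_mul]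
          congr 1
          have hsub : ∫ t in (0 : ℝ)..ξ, g t = ∫ s in (0 : ℝ)..ξ, g (ξ - s) := by
            simp
          rw [hsub, intervalIntegral.integral_of_le hξ.1.le,
            ← integral_indicator measurableSet_Ioc, ← integral_indicator measurableSet_Ioc]
          refine integral_congr_ae ?_
          filter_upwards [Measure.ae_ne volume ξ] with s hs
          have := hξ.2
          simp only [indicator, hB, mem_Ioc]
          grind
        · simp [hA, indicator_of_notMem hξ]
    _ = ∫ s in Ioc 0 x, ∫ ξ, A ξ * B (ξ - s) := hswap.symm
    _ = ∫ s in Ioc 0 x, ∫ ξ in s..x, f ξ * g (ξ - s) := by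
        refine setIntegral_congr_fun measurableSet_Ioc fun s hs => ?_
        simp only [intervalIntegral.integral_of_le hs.2]
        rw [← integral_indicator measurableSet_Ioc]
        refine integral_congr_ae (.of_forall fun ξ => ?_)
        have h1 := hs.1
        have h2 := hs.2
        simp only [indicator, hA, hB, mem_Ioc]
        grind

theorem intervalIntegrable_temperedKernel {α : ℝ} (hα : 0 < α) (ρ a b : ℝ) :
    IntervalIntegrable (temperedKernel α ρ) volume a b := by
  have h : IntervalIntegrable (fun x : ℝ => x ^ (α - 1)) volume a b :=
    intervalIntegral.intervalIntegrable_rpow' (by linarith)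
  exact (h.div_const (Gamma α)).mul_continuousOn (by fun_prop)

theorem integral_rpow_mul_sub_rpow {α β y : ℝ} (hα : 0 < α) (hβ : 0 < β) (hy : 0 < y) :
    ∫ ξ in (0 : ℝ)..y, (y - ξ) ^ (α - 1) * ξ ^ (β - 1) =
      y ^ (α + β - 1) * (Gamma α * Gamma β / Gamma (α + β)) := by
  have hbeta := Complex.betaIntegral_scaled β α hy
  have hgamma := Complex.Gamma_mul_Gamma_eq_betaIntegral (s := β) (t := α) (by simpa) (by simpa)
  have hne : (Complex.Gamma (β + α)) ≠ 0 :=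
    Complex.Gamma_ne_zero_of_re_pos (by simp; positivity)
  rw [mul_comm _ (Complex.betaIntegral _ _), ← div_eq_iff hne] at hgamma
  apply Complex.ofReal_injective
  rw [← intervalIntegral.integral_ofReal]
  trans ∫ ξ in (0 : ℝ)..y, (ξ : ℂ) ^ ((β : ℂ) - 1) * ((y : ℂ) - ξ) ^ ((α : ℂ) - 1)
  · refine intervalIntegral.integral_congr fun ξ hξ => ?_
    rw [Set.uIcc_of_le hy.le] at hξ
    push_cast [Complex.ofReal_cpow hξ.1, Complex.ofReal_cpow (sub_nonneg.2 hξ.2)]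
    ring
  · rw [hbeta, ← hgamma]
    push_cast [Complex.ofReal_cpow hy.le, ← Complex.Gamma_ofReal]
    rw [add_comm (β : ℂ), mul_comm (Complex.Gamma β)]

/-- The tempered kernels form a convolution semigroup in the exponent. -/
theorem integral_temperedKernel_mul_temperedKernel {α β y : ℝ} (hα : 0 < α) (hβ : 0 < β)
    (ρ : ℝ) (hy : 0 < y) :
    ∫ ξ in (0 : ℝ)..y, temperedKernel α ρ (y - ξ) * temperedKernel β ρ ξ =
      temperedKernel (α + β) ρ y := by
  have hfun : ∀ ξ : ℝ, temperedKernel α ρ (y - ξ) * temperedKernel β ρ ξ =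
      exp (-(ρ * y)) / (Gamma α * Gamma β) * ((y - ξ) ^ (α - 1) * ξ ^ (β - 1)) := by
    intro ξ
    have hexp : exp (-(ρ * y)) = exp (-(ρ * (y - ξ))) * exp (-(ρ * ξ)) := by
      rw [← exp_add]; ring_nf
    rw [temperedKernel, temperedKernel, hexp]
    ring
  simp only [hfun]
  rw [intervalIntegral.integral_const_mul, integral_rpow_mul_sub_rpow hα hβ hy, temperedKernel]
  have := (Gamma_pos_of_pos hα).ne'
  have := (Gamma_pos_of_pos hβ).ne'
  field_simp

theorem temperedKernel_one (ρ x : ℝ) : temperedKernel 1 ρ x = exp (-(ρ * x)) := by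
  simp [temperedKernel]

/-- The tempered kernels `κ = h_{α,ρ}` and `k = h_{1-α,ρ} + ρ·∫₀ˣ h_{1-α,ρ}` form a
pair of Sonin kernels. -/
theorem tempered_kernels_sonin (α ρ : ℝ) (hα0 : 0 < α) (hα1 : α < 1) (hρ : 0 < ρ)
    (x : ℝ) (hx : 0 < x) :
    ∫ ξ in (0:ℝ)..x, temperedKernel α ρ (x - ξ) *
      (temperedKernel (1 - α) ρ ξ + ρ * ∫ t in (0:ℝ)..ξ, temperedKernel (1 - α) ρ t) = 1 := by
  have hβ : 0 < 1 - α := sub_pos.2 hα1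
  have hconv : ∀ y : ℝ, 0 < y → ∫ ξ in (0 : ℝ)..y,
      temperedKernel α ρ (y - ξ) * temperedKernel (1 - α) ρ ξ = exp (-(ρ * y)) := by
    intro y hy
    rw [integral_temperedKernel_mul_temperedKernel hα0 hβ ρ hy, add_sub_cancel,
      temperedKernel_one]
  have hf : IntervalIntegrable (fun ξ => temperedKernel α ρ (x - ξ)) volume 0 x := by
    simpa using (intervalIntegrable_temperedKernel hα0 ρ x 0).comp_sub_left x
  have hg := intervalIntegrable_temperedKernel hβ ρ
  have hprod : IntervalIntegrable
      (fun ξ => temperedKernel α ρ (x - ξ) * temperedKernel (1 - α) ρ ξ) volume 0 x := by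
    refine intervalIntegral.intervalIntegrable_of_integral_ne_zero ?_
    rw [hconv x hx]
    exact (exp_pos _).ne'
  have hprim : IntervalIntegrable (fun ξ => temperedKernel α ρ (x - ξ) *
      ∫ t in (0 : ℝ)..ξ, temperedKernel (1 - α) ρ t) volume 0 x :=
    hf.mul_continuousOn (intervalIntegral.continuous_primitive hg 0).continuousOn
  have hinner : ∫ ξ in (0 : ℝ)..x, temperedKernel α ρ (x - ξ) *
      ∫ t in (0 : ℝ)..ξ, temperedKernel (1 - α) ρ t =
        ∫ s in (0 : ℝ)..x, exp (-(ρ * (x - s))) := by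
    rw [integral_mul_primitive_eq_integral_integral hx.le hf (hg 0 x)]
    refine intervalIntegral.integral_congr_ae ?_
    filter_upwards [Measure.ae_ne volume x] with s hsx hs
    rw [Set.uIoc_of_le hx.le] at hs
    rw [← hconv (x - s) (sub_pos.2 (lt_of_le_of_ne hs.2 hsx))]
    have h := intervalIntegral.integral_comp_sub_right (a := s) (b := x)
      (fun ξ => temperedKernel α ρ (x - s - ξ) * temperedKernel (1 - α) ρ ξ) s
    simpa using h
  have hexp : ∫ s in (0 : ℝ)..x, exp (-(ρ * (x - s))) = (1 - exp (-(ρ * x))) / ρ := by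
    have hderiv : ∀ s ∈ Set.uIcc 0 x,
        HasDerivAt (fun s => exp (-(ρ * (x - s))) / ρ) (exp (-(ρ * (x - s)))) s := by
      intro s _
      have h := ((((hasDerivAt_id s).const_sub x).const_mul ρ).neg.exp).div_const ρ
      exact h.congr_deriv (by simp [hρ.ne'])
    rw [intervalIntegral.integral_eq_sub_of_hasDerivAt hderiv
      (by apply Continuous.intervalIntegrable; fun_prop)]
    simp
    ring
  simp only [mul_add, mul_left_comm _ ρ]
  rw [intervalIntegral.integral_add hprod (hprim.const_mul ρ),
    intervalIntegral.integral_const_mul, hconv x hx, hinner, hexp]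
  field_simp
  ring
end

section
/- Let 0 < α < β < 1. Then the functions κ(x) = h_{1−β+α}(x) + h_{1−β}(x) and k(x) = x^{β−1} E_{α,β}(−x^α), where E_{α,β} is the two-parameter Mittag-Leffler function, form a pair of Sonin kernels: for all x > 0, (κ * k)(x) = 1. -/
open MeasureTheory Real

/-- The two-parameter Mittag-Leffler function `E_{α,β}(z) = Σₙ zⁿ/Γ(αn+β)`. -/
noncomputable def mittagLeffler (α β z : ℝ) : ℝ := ∑' n : ℕ, z ^ n / Real.Gamma (α * n + β)

/-- A lower bound for `Γ(s + 1)` growing faster than any fixed geometric sequence. -/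
lemma rpow_mul_exp_neg_le_Gamma {s T : ℝ} (hs : 0 ≤ s) (hT : 0 < T) :
    T ^ s * Real.exp (-T) ≤ Real.Gamma (s + 1) := by
  have hint := Real.GammaIntegral_convergent (s := s + 1) (by linarith)
  have hsub : Set.Ioi T ⊆ Set.Ioi (0 : ℝ) := Set.Ioi_subset_Ioi hT.le
  rw [Real.Gamma_eq_integral (by linarith : 0 < s + 1)]
  calc T ^ s * Real.exp (-T) = ∫ t in Set.Ioi T, T ^ s * Real.exp (-t) := by
        rw [integral_const_mul, integral_exp_neg_Ioi]
    _ ≤ ∫ t in Set.Ioi T, Real.exp (-t) * t ^ (s + 1 - 1) := by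
        refine setIntegral_mono_on ((integrableOn_exp_neg_Ioi T).const_mul _)
          (hint.mono_set hsub) measurableSet_Ioi fun t ht => ?_
        rw [mul_comm, add_sub_cancel_right]
        exact mul_le_mul_of_nonneg_left
          (Real.rpow_le_rpow hT.le (Set.mem_Ioi.1 ht).le hs) (Real.exp_pos _).le
    _ ≤ ∫ t in Set.Ioi 0, Real.exp (-t) * t ^ (s + 1 - 1) := by
        refine setIntegral_mono_set hint ?_ hsub.eventuallyLE
        refine (ae_restrict_mem measurableSet_Ioi).mono fun t ht => ?_
        have : 0 < t := ht
        positivity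

lemma summable_rpow_div_Gamma {α x : ℝ} (hα : 0 < α) (hx : 0 < x) :
    Summable fun n : ℕ => x ^ (α * n) / Real.Gamma (α * n + 1) := by
  have hr : (1 / 2 : ℝ) ^ α < 1 := Real.rpow_lt_one (by norm_num) (by norm_num) hα
  refine Summable.of_nonneg_of_le (fun n => ?_) (fun n => ?_)
    ((summable_geometric_of_lt_one (by positivity) hr).mul_left (Real.exp (2 * x)))
  · have := Real.Gamma_pos_of_pos (by positivity : 0 < α * n + 1)
    positivity
  · have h := rpow_mul_exp_neg_le_Gamma (s := α * n) (T := 2 * x) (by positivity) (by positivity)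
    rw [div_le_iff₀ (Real.Gamma_pos_of_pos (by positivity : 0 < α * n + 1))]
    calc x ^ (α * n) = Real.exp (2 * x) * ((1 / 2 : ℝ) ^ α) ^ n *
          ((2 * x) ^ (α * n) * Real.exp (-(2 * x))) := by
          rw [← Real.rpow_mul_natCast (by norm_num), Real.exp_neg]
          have : x ^ (α * n) = (1 / 2 : ℝ) ^ (α * n) * (2 * x) ^ (α * n) := by
            rw [← Real.mul_rpow (by norm_num) (by positivity)]
            congr 1
            ring
          rw [this]
          field_simp
      _ ≤ _ := mul_le_mul_of_nonneg_left h (by positivity)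

/-- The convolution semigroup property `h_a * h_b = h_{a+b}` of the power kernels. -/
lemma integral_power_kernel_mul_power_kernel {a b x : ℝ} (ha : 0 < a) (hb : 0 < b) (hx : 0 < x) :
    ∫ ξ in (0 : ℝ)..x,
      (x - ξ) ^ (a - 1) / Real.Gamma a * (ξ ^ (b - 1) / Real.Gamma b) =
      x ^ (a + b - 1) / Real.Gamma (a + b) := by
  have hΓa := (Real.Gamma_pos_of_pos ha).ne'
  have hΓb := (Real.Gamma_pos_of_pos hb).ne'
  have key : ∫ ξ in (0 : ℝ)..x, ξ ^ (b - 1) * (x - ξ) ^ (a - 1) =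
      x ^ (b + a - 1) * (Real.Gamma b * Real.Gamma a / Real.Gamma (b + a)) := by
    have h := Complex.betaIntegral_scaled b a hx
    rw [Complex.betaIntegral_eq_Gamma_mul_div _ _ (by simpa) (by simpa)] at h
    apply Complex.ofReal_injective
    rw [← intervalIntegral.integral_ofReal]
    push_cast
    rw [Complex.ofReal_cpow hx.le, ← Complex.Gamma_ofReal, ← Complex.Gamma_ofReal,
      ← Complex.Gamma_ofReal]
    push_cast
    rw [← h]
    refine intervalIntegral.integral_congr fun ξ hξ => ?_
    rw [Set.uIcc_of_le hx.le] at hξ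
    rw [Complex.ofReal_cpow hξ.1, Complex.ofReal_cpow (sub_nonneg.2 hξ.2)]
    push_cast
    rfl
  calc _ = ∫ ξ in (0 : ℝ)..x, (Real.Gamma a * Real.Gamma b)⁻¹ *
        (ξ ^ (b - 1) * (x - ξ) ^ (a - 1)) := by
        congr 1
        ext ξ
        field_simp
    _ = _ := by
        rw [intervalIntegral.integral_const_mul, key, add_comm b a]
        field_simp

lemma intervalIntegrable_power_kernel_mul_power_kernel {a b x : ℝ} (ha : 0 < a) (hb : 0 < b)
    (hx : 0 < x) :
    IntervalIntegrable
      (fun ξ => (x - ξ) ^ (a - 1) / Real.Gamma a * (ξ ^ (b - 1) / Real.Gamma b)) volume 0 x := by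
  by_contra h
  have h0 := intervalIntegral.integral_undef h
  rw [integral_power_kernel_mul_power_kernel ha hb hx] at h0
  have := Real.Gamma_pos_of_pos (add_pos ha hb)
  have : 0 < x ^ (a + b - 1) / Real.Gamma (a + b) := by positivity
  linarith

/-- For `0 < α < β < 1`, the kernels `κ = h_{1-β+α} + h_{1-β}` and
`k(x) = x^{β-1}E_{α,β}(-xᵅ)` form a pair of Sonin kernels. -/
theorem mittagLeffler_kernels_sonin (α β : ℝ) (hα : 0 < α) (hαβ : α < β) (hβ : β < 1)
    (x : ℝ) (hx : 0 < x) :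
    ∫ ξ in (0:ℝ)..x,
      ((x - ξ) ^ ((1 - β + α) - 1) / Real.Gamma (1 - β + α) +
        (x - ξ) ^ ((1 - β) - 1) / Real.Gamma (1 - β)) *
      (ξ ^ (β - 1) * mittagLeffler α β (-ξ ^ α)) = 1 := by
  have hp : 0 < 1 - β + α := by linarith
  have hq : 0 < 1 - β := by linarith
  have hr : ∀ n : ℕ, 0 < α * n + β := fun n => by positivity [hα.trans hαβ]
  set κ : ℝ → ℝ := fun ξ => (x - ξ) ^ ((1 - β + α) - 1) / Real.Gamma (1 - β + α) +
        (x - ξ) ^ ((1 - β) - 1) / Real.Gamma (1 - β) with hκ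
  set a : ℕ → ℝ := fun n => x ^ (α * n) / Real.Gamma (α * n + 1) with ha
  have hsum : Summable a := summable_rpow_div_Gamma hα hx
  let G : ℕ → ℝ → ℝ := fun n ξ => κ ξ * (ξ ^ (α * n + β - 1) / Real.Gamma (α * n + β))
  have hGint : ∀ n, IntervalIntegrable (G n) volume 0 x := fun n => by
    simpa only [G, hκ, add_mul] using
      (intervalIntegrable_power_kernel_mul_power_kernel hp (hr n) hx).add
        (intervalIntegrable_power_kernel_mul_power_kernel hq (hr n) hx)
  have hGval : ∀ n, ∫ ξ in (0 : ℝ)..x, G n ξ = a (n + 1) + a n := fun n => by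
    simp only [G, hκ, add_mul]
    rw [intervalIntegral.integral_add
      (intervalIntegrable_power_kernel_mul_power_kernel hp (hr n) hx)
      (intervalIntegrable_power_kernel_mul_power_kernel hq (hr n) hx),
      integral_power_kernel_mul_power_kernel hp (hr n) hx,
      integral_power_kernel_mul_power_kernel hq (hr n) hx]
    simp only [ha]
    push_cast
    congr 3 <;> ring
  have hGnonneg : ∀ n, ∀ ξ ∈ Set.Ioc 0 x, 0 ≤ G n ξ := fun n ξ hξ => by
    have h1 := Real.Gamma_pos_of_pos hp
    have h2 := Real.Gamma_pos_of_pos hq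
    have h3 := Real.Gamma_pos_of_pos (hr n)
    have h4 : 0 ≤ x - ξ := sub_nonneg.2 hξ.2
    have h5 := hξ.1
    simp only [G, hκ]
    positivity
  let F : ℕ → ℝ → ℝ := fun n ξ => (-1) ^ n * G n ξ
  have hHasSum : HasSum (fun n => ∫ ξ in Set.Ioc 0 x, F n ξ)
      (∫ ξ in Set.Ioc 0 x, ∑' n, F n ξ) := by
    refine hasSum_integral_of_summable_integral_norm
      (fun n => ((intervalIntegrable_iff_integrableOn_Ioc_of_le hx.le).1 (hGint n)).const_mul _) ?_
    refine (((summable_nat_add_iff 1).2 hsum).add hsum).congr fun n => ?_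
    rw [← hGval n, intervalIntegral.integral_of_le hx.le]
    refine setIntegral_congr_fun measurableSet_Ioc fun ξ hξ => ?_
    simp [F, abs_of_nonneg (hGnonneg n ξ hξ)]
  have hTelescope : HasSum (fun n => ∫ ξ in Set.Ioc 0 x, F n ξ) 1 := by
    have hb : Summable fun n => (-1 : ℝ) ^ n * a n :=
      (hsum.abs.congr fun n => by simp [abs_mul]).of_abs
    have hb1 := (summable_nat_add_iff 1).2 hb
    have h := hb.hasSum.sub hb1.hasSum
    rw [hb.tsum_eq_zero_add, add_sub_cancel_right] at h
    have h0 : (-1 : ℝ) ^ 0 * a 0 = 1 := by simp [ha]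
    rw [h0] at h
    refine h.congr_fun fun n => ?_
    simp only [F]
    rw [integral_const_mul, ← intervalIntegral.integral_of_le hx.le, hGval]
    ring
  refine Eq.trans ?_ (hHasSum.unique hTelescope)
  rw [intervalIntegral.integral_of_le hx.le]
  refine setIntegral_congr_fun measurableSet_Ioc fun ξ hξ => ?_
  simp only [mittagLeffler]
  rw [← tsum_mul_left, ← tsum_mul_left]
  refine tsum_congr fun n => ?_
  simp only [F, G, hκ]
  rw [neg_pow, ← Real.rpow_mul_natCast hξ.1.le, add_sub_assoc (α * n), Real.rpow_add hξ.1]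
  ring
end
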